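/- Define Q₄(λ) = sup over ψ ∈ 𝒰 and f with ‖f‖_{L⁴(ℝ)} ≤ 1 of ‖T_λ^ψ f‖_{L⁴(ℝ²)}. Then there is an absolute constant C such that Q₄(λ) ≤ C · λ^{-3/8} for all λ ≥ 1. -/

import Mathlib

open MeasureTheory

/-- The (2+1)-dimensional oscillatory integral operator
`T_λ^ψ f(x,y) = ∫ e^{iλ(x²t + y t²)} ψ(x,y,t) f(t) dt`. -/
noncomputable def T (lam : ℝ) (ψ : ℝ → ℝ → ℝ → ℂ) (f : ℝ → ℂ) (x y : ℝ) : ℂ :=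
  ∫ t : ℝ, Complex.exp (Complex.I * lam * (x ^ 2 * t + y * t ^ 2)) * ψ x y t * f t

/-- The class 𝒰 of smooth cutoffs ψ with supp ψ ⊂ [-1,1]³ and |∂_t^j ψ| ≤ 1 for j = 1,2,3. -/
def inU (ψ : ℝ → ℝ → ℝ → ℂ) : Prop :=
  ContDiff ℝ (⊤ : ℕ∞) (fun p : ℝ × ℝ × ℝ => ψ p.1 p.2.1 p.2.2) ∧
  (∀ x y t : ℝ, ψ x y t ≠ 0 → |x| ≤ 1 ∧ |y| ≤ 1 ∧ |t| ≤ 1) ∧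
  (∀ j : ℕ, 1 ≤ j → j ≤ 3 → ∀ x y t : ℝ, ‖iteratedDeriv j (ψ x y) t‖ ≤ 1)

/-- `Q₄(λ)`: the supremum of `‖T_λ^ψ f‖_{L⁴(ℝ²)}` over `ψ ∈ 𝒰` and `‖f‖_{L⁴(ℝ)} ≤ 1`. -/
noncomputable def Q4 (lam : ℝ) : ENNReal :=
  ⨆ (ψ : ℝ → ℝ → ℝ → ℂ) (_ : inU ψ) (f : ℝ → ℂ) (_ : eLpNorm f 4 volume ≤ 1),
    eLpNorm (fun q : ℝ × ℝ => T lam ψ f q.1 q.2) 4 volume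


open Set ENNReal

lemma aux_sing_fin : ∫⁻ u in Icc (-4:ℝ) 4, ‖u‖ₑ ^ (-(3:ℝ)/4) ≠ ⊤ := by
  have h1 : ∫⁻ u in Ioc (0:ℝ) 4, ‖u‖ₑ ^ (-(3:ℝ)/4) ≠ ⊤ := by
    have h := (intervalIntegral.intervalIntegrable_rpow' (a := 0) (b := 4) (r := -(3:ℝ)/4)
      (by norm_num)).1
    have h2 := h.2
    unfold HasFiniteIntegral at h2
    have : ∫⁻ u in Ioc (0:ℝ) 4, ‖u‖ₑ ^ (-(3:ℝ)/4) = ∫⁻ u in Ioc (0:ℝ) 4, ‖u ^ (-(3:ℝ)/4)‖ₑ := by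
      apply setLIntegral_congr_fun measurableSet_Ioc
      intro u hu
      have hu0 : 0 < u := hu.1
      simp only
      rw [Real.enorm_eq_ofReal hu0.le, Real.enorm_eq_ofReal (by positivity),
        ENNReal.ofReal_rpow_of_pos hu0]
    rw [this]; exact h2.ne
  have h2 : ∫⁻ u in Ico (-4:ℝ) 0, ‖u‖ₑ ^ (-(3:ℝ)/4) = ∫⁻ u in Ioc (0:ℝ) 4, ‖u‖ₑ ^ (-(3:ℝ)/4) := by
    rw [← lintegral_indicator measurableSet_Ico, ← lintegral_indicator measurableSet_Ioc,
      ← lintegral_neg_eq_self]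
    congr 1
    ext u
    by_cases hu : u ∈ Ioc (0:ℝ) 4
    · have : -u ∈ Ico (-4:ℝ) 0 := by constructor <;> linarith [hu.1, hu.2]
      simp [indicator, hu.1, hu.2]
    · have : ¬ (-u ∈ Ico (-4:ℝ) 0) := fun h => hu (by constructor <;> linarith [h.1, h.2])
      simp only [indicator, hu, this, if_false]
  have h3 : (Icc (-4:ℝ) 4) ⊆ Ico (-4:ℝ) 0 ∪ ({0} ∪ Ioc (0:ℝ) 4) := by
    intro u hu
    rcases lt_trichotomy u 0 with h | h | h
    · left; exact ⟨hu.1, h⟩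
    · right; left; exact h
    · right; right; exact ⟨h, hu.2⟩
  refine ne_top_of_le_ne_top ?_ (lintegral_mono_set h3)
  refine ne_top_of_le_ne_top ?_ (lintegral_union_le _ _ _)
  refine ENNReal.add_ne_top.2 ⟨h2 ▸ h1, ?_⟩
  refine ne_top_of_le_ne_top ?_ (lintegral_union_le _ _ _)
  refine ENNReal.add_ne_top.2 ⟨by simp, h1⟩

noncomputable def cA : ℝ≥0∞ := ∫⁻ u in Icc (-4:ℝ) 4, ‖u‖ₑ ^ (-(3:ℝ)/4)

lemma aux_sing (p : ℝ) (hp : |p| ≤ 2) :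
    ∫⁻ u in Icc (-2:ℝ) 2, ‖p - u‖ₑ ^ (-(3:ℝ)/4) ≤ cA := by
  unfold cA
  rw [← lintegral_indicator measurableSet_Icc, ← lintegral_indicator measurableSet_Icc,
    ← lintegral_sub_left_eq_self ((Icc (-4:ℝ) 4).indicator _) p]
  apply lintegral_mono
  intro u
  rw [abs_le] at hp
  by_cases hu : u ∈ Icc (-2:ℝ) 2
  · have : p - u ∈ Icc (-4:ℝ) 4 := by constructor <;> linarith [hu.1, hu.2]
    simp only [indicator, hu, this, if_true]; exact le_rfl
  · simp only [indicator, hu, if_false]; exact zero_le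

/-- Gaussian profile. -/
noncomputable def gph (z : ℝ) : ℝ≥0∞ := ENNReal.ofReal (Real.exp (-z ^ 2 / 4))

lemma gph_meas : Measurable gph := by unfold gph; fun_prop

noncomputable def cB : ℝ≥0∞ := ∫⁻ z, gph z

lemma cB_fin : cB ≠ ⊤ := by
  have h := (integrable_exp_neg_mul_sq (b := 1/4) (by norm_num))
  have h2 := h.lintegral_lt_top
  unfold cB gph
  convert h2.ne using 5
  ring

lemma aux_N (lam c A : ℝ) (hl : 0 < lam) (hc : 0 < c) :
    ∫⁻ r in Ioi (0:ℝ), ENNReal.ofReal r * gph (lam * (A - c * r ^ 2))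
      ≤ cB * ENNReal.ofReal ((2 * lam * c)⁻¹) := by
  have hd : ∀ r ∈ Ioi (0:ℝ), HasDerivWithinAt (fun r : ℝ => lam * c * r ^ 2) (2 * lam * c * r) (Ioi 0) r := by
    intro r _
    have := ((hasDerivAt_pow 2 r).const_mul (lam * c)).hasDerivWithinAt (s := Ioi 0)
    refine this.congr_deriv ?_
    norm_num; ring
  have hinj : InjOn (fun r : ℝ => lam * c * r ^ 2) (Ioi 0) := by
    intro a ha b hb hab
    have h : lam * c ≠ 0 := by positivity
    have := mul_left_cancel₀ h hab
    exact (pow_left_inj₀ (le_of_lt ha) (le_of_lt hb) two_ne_zero).1 this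
  have h := lintegral_image_eq_lintegral_abs_deriv_mul measurableSet_Ioi hd hinj
    (fun s => gph (lam * A - s))
  have h2 : ∫⁻ r in Ioi (0:ℝ), ENNReal.ofReal r * gph (lam * (A - c * r ^ 2))
      = ENNReal.ofReal ((2 * lam * c)⁻¹) * ∫⁻ x in Ioi (0:ℝ), ENNReal.ofReal |2 * lam * c * x| * gph (lam * A - lam * c * x ^ 2) := by
    rw [← lintegral_const_mul']
    · apply setLIntegral_congr_fun measurableSet_Ioi
      intro r hr
      have hr0 : 0 < r := hr
      simp only
      rw [← mul_assoc, ← ENNReal.ofReal_mul (by positivity), abs_of_pos (by positivity)]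
      congr 2
      · field_simp
      · ring
    · simp
  rw [h2, ← h, mul_comm]
  gcongr
  calc _ ≤ ∫⁻ s, gph (lam * A - s) := setLIntegral_le_lintegral _ _
    _ = cB := lintegral_sub_left_eq_self _ _

lemma aux_N' (lam c A : ℝ) (hl : 0 < lam) (hc : 0 < c) :
    ∫⁻ r, ‖r‖ₑ * gph (lam * (A - c * r ^ 2))
      ≤ 2 * (cB * ENNReal.ofReal ((2 * lam * c)⁻¹)) := by
  have h1 : ∫⁻ r in Ioi (0:ℝ), ‖r‖ₑ * gph (lam * (A - c * r ^ 2)) ≤ cB * ENNReal.ofReal ((2 * lam * c)⁻¹) := by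
    refine le_trans (le_of_eq ?_) (aux_N lam c A hl hc)
    apply setLIntegral_congr_fun measurableSet_Ioi
    intro r hr
    simp only
    rw [Real.enorm_eq_ofReal (le_of_lt hr)]
  have h2 : ∫⁻ r in Iio (0:ℝ), ‖r‖ₑ * gph (lam * (A - c * r ^ 2)) = ∫⁻ r in Ioi (0:ℝ), ‖r‖ₑ * gph (lam * (A - c * r ^ 2)) := by
    rw [← lintegral_indicator measurableSet_Iio, ← lintegral_indicator measurableSet_Ioi,
      ← lintegral_neg_eq_self]
    congr 1
    ext u
    simp [indicator]
  have h3 : (univ : Set ℝ) ⊆ Iio 0 ∪ ({0} ∪ Ioi 0) := by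
    intro u _
    rcases lt_trichotomy u 0 with h | h | h
    · left; exact h
    · right; left; exact h
    · right; right; exact h
  rw [← setLIntegral_univ]
  refine (lintegral_mono_set h3).trans ?_
  refine (lintegral_union_le _ _ _).trans ?_
  rw [two_mul]
  refine add_le_add (h2 ▸ h1) ?_
  refine (lintegral_union_le _ _ _).trans ?_
  simpa using h1

lemma aux_polar (lam q : ℝ) (hl : 0 < lam) :
    ∫⁻ z : ℝ × ℝ, gph (lam * (q - z.1 ^ 2 - z.2 ^ 2)) ≤
      cB * ENNReal.ofReal ((2 * lam)⁻¹) * ENNReal.ofReal (2 * Real.pi) := by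
  rw [← lintegral_comp_polarCoord_symm]
  rw [polarCoord_target, Measure.volume_eq_prod, ← Measure.prod_restrict]
  have : ∀ p : ℝ × ℝ, ENNReal.ofReal p.1 • gph (lam * (q - (polarCoord.symm p).1 ^ 2 - (polarCoord.symm p).2 ^ 2))
     = (ENNReal.ofReal p.1 * gph (lam * (q - 1 * p.1 ^ 2))) * 1 := by
    intro p
    simp only [polarCoord_symm_apply, smul_eq_mul, mul_one]
    congr 3
    nlinarith [Real.sin_sq_add_cos_sq p.2]
  simp_rw [this]
  have := gph_meas
  rw [lintegral_prod_mul (f := fun r : ℝ => ENNReal.ofReal r * gph (lam * (q - 1 * r ^ 2))) (g := fun _ => 1)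
    (by fun_prop) (by fun_prop)]
  have h := aux_N lam 1 q hl one_pos
  rw [mul_one] at h
  gcongr
  rw [lintegral_one, Measure.restrict_apply_univ, Real.volume_Ioo]
  exact le_of_eq (by congr 1; ring)

/-- Lebesgue measure on `[-1,1]`. -/
noncomputable def nu : Measure ℝ := volume.restrict (Icc (-1:ℝ) 1)

instance nu_fin : IsFiniteMeasure nu := by unfold nu; infer_instance

lemma aux_pt (a b : ℝ≥0∞) (ha : a ≤ 2) :
    a ^ ((3:ℝ)/4) * b ^ (-(1:ℝ)/2) ≤ 2 + a * b ^ (-(3:ℝ)/4) := by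
  have hat : a ≠ ⊤ := ne_top_of_le_ne_top (by simp) ha
  rcases eq_or_ne a 0 with rfl | ha0
  · rw [ENNReal.zero_rpow_of_pos (by norm_num)]; simp
  rcases le_or_gt a b with hab | hab
  · refine le_trans ?_ le_self_add
    calc a ^ ((3:ℝ)/4) * b ^ (-(1:ℝ)/2) ≤ a ^ ((3:ℝ)/4) * a ^ (-(1:ℝ)/2) := by
          gcongr a ^ ((3:ℝ)/4) * ?_
          rw [neg_div, ENNReal.rpow_neg, ENNReal.rpow_neg]
          gcongr
      _ = a ^ ((1:ℝ)/4) := by rw [← ENNReal.rpow_add _ _ ha0 hat]; norm_num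
      _ ≤ 2 ^ ((1:ℝ)/4) := by gcongr
      _ ≤ 2 ^ (1:ℝ) := ENNReal.rpow_le_rpow_of_exponent_le (by norm_num) (by norm_num)
      _ = 2 := by simp
  · refine le_trans ?_ le_add_self
    rcases eq_or_ne b 0 with rfl | hb0
    · rw [ENNReal.zero_rpow_of_neg (y := -(3:ℝ)/4) (by norm_num), ENNReal.mul_top ha0]; exact le_top
    · have hbt : b ≠ ⊤ := ne_top_of_lt hab
      calc a ^ ((3:ℝ)/4) * b ^ (-(1:ℝ)/2) = a * a ^ (-(1:ℝ)/4) * b ^ (-(1:ℝ)/2) := by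
            congr 1
            nth_rewrite 2 [← ENNReal.rpow_one a]
            rw [← ENNReal.rpow_add _ _ ha0 hat]; norm_num
        _ ≤ a * b ^ (-(1:ℝ)/4) * b ^ (-(1:ℝ)/2) := by
            gcongr a * ?_ * _
            rw [neg_div, ENNReal.rpow_neg, ENNReal.rpow_neg]
            gcongr
        _ = a * b ^ (-(3:ℝ)/4) := by
            rw [mul_assoc, ← ENNReal.rpow_add _ _ hb0 hbt]; norm_num

lemma aux_B (lam p q : ℝ) (hl : 0 < lam) (hp : |p| ≤ 2) :
    ∫⁻ z : ℝ × ℝ, ‖z.1 - z.2‖ₑ * (Icc (-2:ℝ) 2).indicator (fun u => ‖p - u‖ₑ ^ (-(3:ℝ)/4)) (z.1 + z.2)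
      * gph (lam * (q - z.1 ^ 2 - z.2 ^ 2)) ≤ cA * (cB * ENNReal.ofReal (lam⁻¹)) := by
  set J : ℝ → ℝ≥0∞ := (Icc (-2:ℝ) 2).indicator (fun u => ‖p - u‖ₑ ^ (-(3:ℝ)/4)) with hJ
  have hJm : Measurable J := by
    apply Measurable.indicator _ measurableSet_Icc
    fun_prop
  have hg := gph_meas
  have hJi : ∫⁻ u, J u ≤ cA := by
    rw [hJ, lintegral_indicator measurableSet_Icc]; exact aux_sing p hp
  rw [Measure.volume_eq_prod, lintegral_prod_symm' _ (by fun_prop)]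
  have h1 : ∀ y : ℝ, ∫⁻ x : ℝ, ‖x - y‖ₑ * J (x + y) * gph (lam * (q - x ^ 2 - y ^ 2))
      = ∫⁻ u : ℝ, ‖u - 2 * y‖ₑ * J u * gph (lam * (q - (u - y) ^ 2 - y ^ 2)) := by
    intro y
    rw [← lintegral_add_right_eq_self (fun u : ℝ => ‖u - 2 * y‖ₑ * J u * gph (lam * (q - (u - y) ^ 2 - y ^ 2))) y]
    congr 1; ext x
    rw [show x + y - 2 * y = x - y by ring, show x + y - y = x by ring]
  simp only [h1]
  rw [lintegral_lintegral_swap (by fun_prop)]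
  have h2 : ∀ u : ℝ, ∫⁻ y : ℝ, ‖u - 2 * y‖ₑ * J u * gph (lam * (q - (u - y) ^ 2 - y ^ 2))
      ≤ J u * (cB * ENNReal.ofReal (lam⁻¹)) := by
    intro u
    rw [← lintegral_add_right_eq_self _ (u/2)]
    have : ∀ y : ℝ, ‖u - 2 * (y + u/2)‖ₑ * J u * gph (lam * (q - (u - (y + u/2)) ^ 2 - (y + u/2) ^ 2))
      = (J u * 2) * (‖y‖ₑ * gph (lam * ((q - u^2/2) - 2 * y ^ 2))) := by
      intro y
      have e1 : u - 2 * (y + u/2) = -(2 * y) := by ring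
      have e2 : ‖(2:ℝ)‖ₑ = 2 := by
        rw [Real.enorm_eq_ofReal (by norm_num)]; simp
      have e3 : (q - (u - (y + u/2)) ^ 2 - (y + u/2) ^ 2) = ((q - u^2/2) - 2 * y ^ 2) := by ring
      rw [e1, enorm_neg, enorm_mul, e2, e3]; ring
    simp only [this]
    rw [lintegral_const_mul _ (by fun_prop), mul_assoc]
    gcongr J u * ?_
    calc _ ≤ 2 * (2 * (cB * ENNReal.ofReal ((2 * lam * 2)⁻¹))) := by
          gcongr; exact aux_N' lam 2 _ hl two_pos
      _ = cB * ENNReal.ofReal (lam⁻¹) := by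
          have : lam⁻¹ = 4 * (2 * lam * 2)⁻¹ := by field_simp; norm_num
          rw [this, ENNReal.ofReal_mul (by norm_num)]
          have : ENNReal.ofReal 4 = 4 := by simp
          rw [this]; ring
  calc _ ≤ ∫⁻ u, J u * (cB * ENNReal.ofReal (lam⁻¹)) := lintegral_mono h2
    _ = (∫⁻ u, J u) * (cB * ENNReal.ofReal (lam⁻¹)) := lintegral_mul_const _ hJm
    _ ≤ _ := by gcongr

noncomputable def cM : ℝ≥0∞ := 2 * (cB * ENNReal.ofReal Real.pi) + cA * cB

lemma aux_M (lam p q : ℝ) (hl : 0 < lam) (hp : |p| ≤ 2) :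
    ∫⁻ z : ℝ × ℝ, ‖z.1 - z.2‖ₑ ^ ((3:ℝ)/4) * (‖p - z.1 - z.2‖ₑ ^ (-(1:ℝ)/2)
      * gph (lam * (q - z.1 ^ 2 - z.2 ^ 2))) ∂(nu.prod nu) ≤ cM * ENNReal.ofReal (lam⁻¹) := by
  have hg := gph_meas
  set J : ℝ → ℝ≥0∞ := (Icc (-2:ℝ) 2).indicator (fun u => ‖p - u‖ₑ ^ (-(3:ℝ)/4)) with hJ
  have hJm : Measurable J := by
    apply Measurable.indicator _ measurableSet_Icc
    fun_prop
  unfold nu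
  rw [Measure.prod_restrict, ← Measure.volume_eq_prod]
  calc _ ≤ ∫⁻ z : ℝ × ℝ in Icc (-1:ℝ) 1 ×ˢ Icc (-1:ℝ) 1,
        (2 * gph (lam * (q - z.1 ^ 2 - z.2 ^ 2)) +
          ‖z.1 - z.2‖ₑ * J (z.1 + z.2) * gph (lam * (q - z.1 ^ 2 - z.2 ^ 2))) := by
        apply setLIntegral_mono' (measurableSet_Icc.prod measurableSet_Icc)
        rintro ⟨x, y⟩ ⟨⟨hx1, hx2⟩, hy1, hy2⟩
        simp only at hx1 hx2 hy1 hy2 ⊢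
        rw [← add_mul, ← mul_assoc]
        gcongr
        have : J (x + y) = ‖p - x - y‖ₑ ^ (-(3:ℝ)/4) := by
          rw [hJ, indicator_of_mem (by constructor <;> linarith), sub_sub]
        rw [this]
        apply aux_pt
        rw [Real.enorm_eq_ofReal_abs]
        apply ENNReal.ofReal_le_of_le_toReal
        simp only [toReal_ofNat]
        rw [abs_le]; constructor <;> linarith
    _ ≤ ∫⁻ z : ℝ × ℝ, (2 * gph (lam * (q - z.1 ^ 2 - z.2 ^ 2)) +
          ‖z.1 - z.2‖ₑ * J (z.1 + z.2) * gph (lam * (q - z.1 ^ 2 - z.2 ^ 2))) :=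
        setLIntegral_le_lintegral _ _
    _ = 2 * (∫⁻ z : ℝ × ℝ, gph (lam * (q - z.1 ^ 2 - z.2 ^ 2))) +
          ∫⁻ z : ℝ × ℝ, ‖z.1 - z.2‖ₑ * J (z.1 + z.2) * gph (lam * (q - z.1 ^ 2 - z.2 ^ 2)) := by
        rw [lintegral_add_left (by fun_prop), lintegral_const_mul _ (by fun_prop)]
    _ ≤ 2 * (cB * ENNReal.ofReal ((2 * lam)⁻¹) * ENNReal.ofReal (2 * Real.pi))
        + cA * (cB * ENNReal.ofReal (lam⁻¹)) := by
        gcongr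
        · exact aux_polar lam q hl
        · exact aux_B lam p q hl hp
    _ = _ := by
        have : ENNReal.ofReal ((2 * lam)⁻¹) * ENNReal.ofReal (2 * Real.pi)
          = ENNReal.ofReal Real.pi * ENNReal.ofReal (lam⁻¹) := by
          rw [← ENNReal.ofReal_mul (by positivity), ← ENNReal.ofReal_mul (by positivity)]
          congr 1; field_simp
        unfold cM
        rw [mul_assoc cB, this]; ring

lemma aux_sing_nu (p : ℝ) (hp : |p| ≤ 2) : ∫⁻ u, ‖p - u‖ₑ ^ (-(3:ℝ)/4) ∂nu ≤ cA := by
  refine le_trans ?_ (aux_sing p hp)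
  unfold nu
  exact lintegral_mono_set (Icc_subset_Icc (by norm_num) (by norm_num))

lemma nu_ae : ∀ᵐ t ∂nu, |t| ≤ 1 := by
  unfold nu
  refine (ae_restrict_iff' measurableSet_Icc).2 (Filter.Eventually.of_forall fun t ht => abs_le.2 ht)

lemma aux_D (h : ℝ → ℝ≥0∞) (hm : Measurable h) :
    ∫⁻ z : ℝ × ℝ, (h z.1 * h z.2) ^ 2 * ‖z.1 - z.2‖ₑ ^ (-(3:ℝ)/4) ∂(nu.prod nu)
      ≤ 2 * cA * ∫⁻ t, h t ^ 4 ∂nu := by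
  have hp : ∀ a b : ℝ≥0∞, (a * b) ^ 2 ≤ a ^ 4 + b ^ 4 := by
    intro a b
    rcases le_total a b with hab | hab
    · refine le_trans ?_ le_add_self
      calc (a * b) ^ 2 ≤ (b * b) ^ 2 := by gcongr
        _ = b ^ 4 := by ring
    · refine le_trans ?_ le_self_add
      calc (a * b) ^ 2 ≤ (a * a) ^ 2 := by gcongr
        _ = a ^ 4 := by ring
  have hk : ∫⁻ x, ∫⁻ y, h x ^ 4 * ‖x - y‖ₑ ^ (-(3:ℝ)/4) ∂nu ∂nu ≤ cA * ∫⁻ t, h t ^ 4 ∂nu := by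
    rw [← lintegral_const_mul _ (by fun_prop)]
    apply lintegral_mono_ae
    filter_upwards [nu_ae] with x hx
    rw [lintegral_const_mul _ (by fun_prop), mul_comm]
    gcongr
    exact aux_sing_nu x (by linarith)
  calc _ ≤ ∫⁻ z : ℝ × ℝ, (h z.1 ^ 4 * ‖z.1 - z.2‖ₑ ^ (-(3:ℝ)/4) +
        h z.2 ^ 4 * ‖z.2 - z.1‖ₑ ^ (-(3:ℝ)/4)) ∂(nu.prod nu) := by
        apply lintegral_mono
        intro z
        simp only
        rw [← enorm_neg (z.2 - z.1), neg_sub, ← add_mul]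
        gcongr
        exact hp _ _
    _ = (∫⁻ x, ∫⁻ y, h x ^ 4 * ‖x - y‖ₑ ^ (-(3:ℝ)/4) ∂nu ∂nu) +
      (∫⁻ x, ∫⁻ y, h x ^ 4 * ‖x - y‖ₑ ^ (-(3:ℝ)/4) ∂nu ∂nu) := by
        rw [lintegral_add_left (by fun_prop)]
        congr 1
        · rw [lintegral_prod _ (by fun_prop)]
        · rw [lintegral_prod_symm' _ (by fun_prop)]
    _ ≤ cA * (∫⁻ t, h t ^ 4 ∂nu) + cA * (∫⁻ t, h t ^ 4 ∂nu) := add_le_add hk hk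
    _ = _ := by ring

lemma aux_amgm (a b w v : ℝ≥0∞) (hw : w ≠ 0) (hwt : w ≠ ⊤) (hvt : v ≠ ⊤) :
    a * b ≤ a ^ 2 * (w ^ (-(3:ℝ)/4) * v ^ ((3:ℝ)/4)) + b ^ 2 * (v ^ (-(3:ℝ)/4) * w ^ ((3:ℝ)/4)) := by
  have e : (-(3:ℝ)/4) = -(3/4) := by norm_num
  rw [e, ENNReal.rpow_neg, ENNReal.rpow_neg]
  have hW0 : w ^ ((3:ℝ)/4) ≠ 0 := by simp [ENNReal.rpow_eq_zero_iff, hw, hwt]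
  have hWt : w ^ ((3:ℝ)/4) ≠ ⊤ := ENNReal.rpow_ne_top_of_nonneg (by norm_num) hwt
  have hVt : v ^ ((3:ℝ)/4) ≠ ⊤ := ENNReal.rpow_ne_top_of_nonneg (by norm_num) hvt
  generalize w ^ ((3:ℝ)/4) = W at *
  generalize v ^ ((3:ℝ)/4) = V at *
  rcases eq_or_ne V 0 with rfl | hV0
  · rcases eq_or_ne b 0 with rfl | hb
    · simp
    · refine le_trans ?_ le_add_self
      rw [ENNReal.inv_zero, ENNReal.top_mul hW0, ENNReal.mul_top (by simpa using hb)]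
      exact le_top
  rcases le_total (a * V) (b * W) with h | h
  · refine le_trans ?_ le_add_self
    calc a * b = (a * V) * b * V⁻¹ := by
          rw [mul_right_comm a V b, mul_assoc (a * b), ENNReal.mul_inv_cancel hV0 hVt, mul_one]
      _ ≤ (b * W) * b * V⁻¹ := by gcongr
      _ = _ := by ring
  · refine le_trans ?_ le_self_add
    calc a * b = (b * W) * a * W⁻¹ := by
          rw [mul_right_comm b W a, mul_assoc (b * a), ENNReal.mul_inv_cancel hW0 hWt, mul_one, mul_comm]
      _ ≤ (a * V) * a * W⁻¹ := by gcongr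
      _ = _ := by ring

instance nu_noatoms : NullSingletonClass nu := by unfold nu; infer_instance

lemma aux_diag : ∀ᵐ z ∂(nu.prod nu), z.1 ≠ z.2 := by
  rw [Measure.ae_prod_iff_ae_ae]
  · refine Filter.Eventually.of_forall fun x => ?_
    have : ∀ᵐ y ∂nu, y ∉ ({x} : Set ℝ) := measure_eq_zero_iff_ae_notMem.1 (measure_singleton x)
    filter_upwards [this] with y hy h
    exact hy h.symm
  · exact (measurableSet_eq_fun measurable_fst measurable_snd).compl

/-- The kernel -/
noncomputable def ker (lam : ℝ) (z w : ℝ × ℝ) : ℝ≥0∞ :=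
  ‖z.1 + z.2 - w.1 - w.2‖ₑ ^ (-(1:ℝ)/2) * gph (lam * (z.1 ^ 2 + z.2 ^ 2 - w.1 ^ 2 - w.2 ^ 2))

lemma ker_symm (lam : ℝ) (z w : ℝ × ℝ) : ker lam z w = ker lam w z := by
  unfold ker gph
  rw [← enorm_neg]
  congr 1
  · congr 2; ring
  · congr 2; ring

lemma ker_meas (lam : ℝ) : Measurable (fun ω : (ℝ × ℝ) × (ℝ × ℝ) => ker lam ω.1 ω.2) := by
  have := gph_meas
  unfold ker
  fun_prop

lemma aux_quad (lam : ℝ) (hl : 0 < lam) (h : ℝ → ℝ≥0∞) (hm : Measurable h) :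
    ∫⁻ ω : (ℝ × ℝ) × (ℝ × ℝ), ((h ω.1.1 * h ω.1.2) * (h ω.2.1 * h ω.2.2)) * ker lam ω.1 ω.2
      ∂((nu.prod nu).prod (nu.prod nu)) ≤
      2 * ((2 * cA * ∫⁻ t, h t ^ 4 ∂nu) * (cM * ENNReal.ofReal lam⁻¹)) := by
  have hk := ker_meas lam
  set μ := nu.prod nu with hμ
  let G : (ℝ × ℝ) × (ℝ × ℝ) → ℝ≥0∞ := fun ω =>
    (h ω.1.1 * h ω.1.2) ^ 2 * (‖ω.1.1 - ω.1.2‖ₑ ^ (-(3:ℝ)/4) * ‖ω.2.1 - ω.2.2‖ₑ ^ ((3:ℝ)/4)) * ker lam ω.1 ω.2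
  have hG : Measurable G := by fun_prop
  have hGi : ∫⁻ ω, G ω ∂(μ.prod μ) ≤ (2 * cA * ∫⁻ t, h t ^ 4 ∂nu) * (cM * ENNReal.ofReal lam⁻¹) := by
    rw [lintegral_prod _ hG.aemeasurable]
    have h1 : ∀ᵐ z ∂μ, ∫⁻ w, G (z, w) ∂μ ≤
        ((h z.1 * h z.2) ^ 2 * ‖z.1 - z.2‖ₑ ^ (-(3:ℝ)/4)) * (cM * ENNReal.ofReal lam⁻¹) := by
      have e1 : ∀ᵐ z ∂μ, |z.1| ≤ 1 := Measure.quasiMeasurePreserving_fst.ae nu_ae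
      have e2 : ∀ᵐ z ∂μ, |z.2| ≤ 1 := Measure.quasiMeasurePreserving_snd.ae nu_ae
      filter_upwards [e1, e2] with z hz1 hz2
      have : ∀ w : ℝ × ℝ, G (z, w) = ((h z.1 * h z.2) ^ 2 * ‖z.1 - z.2‖ₑ ^ (-(3:ℝ)/4)) *
          (‖w.1 - w.2‖ₑ ^ ((3:ℝ)/4) * (‖(z.1 + z.2) - w.1 - w.2‖ₑ ^ (-(1:ℝ)/2) *
            gph (lam * ((z.1 ^ 2 + z.2 ^ 2) - w.1 ^ 2 - w.2 ^ 2)))) := by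
        intro w
        simp only [G, ker]; ring
      simp only [this]
      have := gph_meas
      rw [lintegral_const_mul _ (by fun_prop)]
      gcongr
      exact aux_M lam _ _ hl ((abs_add_le _ _).trans (by linarith))
    refine (lintegral_mono_ae h1).trans ?_
    rw [lintegral_mul_const _ (by fun_prop)]
    gcongr
    exact aux_D h hm
  have hs : ∫⁻ ω, G ω.swap ∂(μ.prod μ) = ∫⁻ ω, G ω ∂(μ.prod μ) := lintegral_prod_swap G
  calc _ ≤ ∫⁻ ω, (G ω + G ω.swap) ∂(μ.prod μ) := by
        apply lintegral_mono_ae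
        have e1 : ∀ᵐ ω ∂(μ.prod μ), ω.1.1 ≠ ω.1.2 := Measure.quasiMeasurePreserving_fst.ae aux_diag
        filter_upwards [e1] with ω hω
        simp only [G, Prod.fst_swap, Prod.snd_swap]
        rw [ker_symm lam ω.2 ω.1, ← add_mul]
        gcongr
        apply aux_amgm
        · simpa [sub_eq_zero] using hω
        · simp
        · simp
    _ = ∫⁻ ω, G ω ∂(μ.prod μ) + ∫⁻ ω, G ω.swap ∂(μ.prod μ) := lintegral_add_left hG _
    _ ≤ _ := by rw [hs, two_mul]; exact add_le_add hGi hGi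

lemma K1_bound (lam P : ℝ) (hl : 0 < lam) :
    ‖∫ x : ℝ, Complex.exp (-(1 - (lam * P : ℝ) * Complex.I) * (x:ℂ) ^ 2)‖ₑ ≤
      ENNReal.ofReal ((Real.pi / lam) ^ ((1:ℝ)/2)) * ‖P‖ₑ ^ (-(1:ℝ)/2) := by
  rcases eq_or_ne P 0 with rfl | hP
  · have : ENNReal.ofReal ((Real.pi / lam) ^ ((1:ℝ)/2)) ≠ 0 := by
      have : 0 < (Real.pi / lam) ^ ((1:ℝ)/2) := by positivity
      simpa using this
    rw [enorm_zero, ENNReal.zero_rpow_of_neg (by norm_num), ENNReal.mul_top this]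
    exact le_top
  have hb : 0 < (1 - ((lam * P : ℝ):ℂ) * Complex.I).re := by simp
  have hP' : 0 < |P| := abs_pos.2 hP
  rw [integral_gaussian_complex hb]
  rw [show (1/2:ℂ) = ((1/2:ℝ):ℂ) by norm_num, ← ofReal_norm, Complex.norm_cpow_real,
    Real.enorm_eq_ofReal_abs, ENNReal.ofReal_rpow_of_pos hP', ← ENNReal.ofReal_mul (by positivity)]
  apply ENNReal.ofReal_le_ofReal
  have h1 : lam * |P| ≤ ‖(1 - ((lam * P : ℝ):ℂ) * Complex.I)‖ := by
    have := Complex.abs_im_le_norm (1 - ((lam * P : ℝ):ℂ) * Complex.I)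
    simpa [abs_mul, abs_of_pos hl] using this
  rw [norm_div, neg_div, Real.rpow_neg hP'.le, ← div_eq_mul_inv, ← Real.div_rpow (by positivity) hP'.le, div_div]
  have : ‖(Real.pi:ℂ)‖ = Real.pi := by simp [abs_of_pos Real.pi_pos]
  rw [this]
  gcongr

lemma K2_bound (s : ℝ) :
    ‖∫ y : ℝ, Complex.exp (Complex.I * s * y) * Complex.exp (-1 * (y:ℂ) ^ 2)‖ₑ =
      ENNReal.ofReal (Real.pi ^ ((1:ℝ)/2)) * gph s := by
  rw [fourierIntegral_gaussian (by simp)]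
  rw [show (1/2:ℂ) = ((1/2:ℝ):ℂ) by norm_num, ← ofReal_norm, norm_mul, Complex.norm_cpow_real, Complex.norm_exp]
  unfold gph
  rw [← ENNReal.ofReal_mul (by positivity)]
  have : ‖(Real.pi:ℂ)‖ = Real.pi := by simp [abs_of_pos Real.pi_pos]
  rw [div_one, this]
  congr 3
  rw [← Complex.ofReal_re (-s^2/4)]
  push_cast
  congr 1; ring

noncomputable def ph (lam x y t : ℝ) : ℂ := Complex.exp (((lam * (x ^ 2 * t + y * t ^ 2) : ℝ) : ℂ) * Complex.I)

lemma ph_norm (lam x y t : ℝ) : ‖ph lam x y t‖ = 1 := Complex.norm_exp_ofReal_mul_I _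

lemma ph_meas (lam : ℝ) : Measurable (fun p : ℝ × ℝ × ℝ => ph lam p.1 p.2.1 p.2.2) := by
  unfold ph; fun_prop

noncomputable def EE (lam : ℝ) (h : ℝ → ℂ) (x y : ℝ) : ℂ := ∫ t, ph lam x y t * h t ∂nu

open scoped ComplexConjugate

noncomputable def FF (lam : ℝ) (h : ℝ → ℂ) (x y : ℝ) (z : ℝ × ℝ) : ℂ :=
  (ph lam x y z.1 * h z.1) * (ph lam x y z.2 * h z.2)

noncomputable def Phi (lam : ℝ) (h : ℝ → ℂ) (q : ℝ × ℝ) (ω : (ℝ × ℝ) × (ℝ × ℝ)) : ℂ :=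
  (Real.exp (-q.1 ^ 2) * Real.exp (-q.2 ^ 2) : ℝ) * (FF lam h q.1 q.2 ω.1 * conj (FF lam h q.1 q.2 ω.2))

lemma EE_four (lam : ℝ) (h : ℝ → ℂ) (q : ℝ × ℝ) :
    ((Real.exp (-q.1 ^ 2) * Real.exp (-q.2 ^ 2) * ‖EE lam h q.1 q.2‖ ^ 4 : ℝ) : ℂ) =
      ∫ ω, Phi lam h q ω ∂((nu.prod nu).prod (nu.prod nu)) := by
  unfold Phi
  rw [integral_const_mul, integral_prod_mul (fun z => FF lam h q.1 q.2 z) (fun z => conj (FF lam h q.1 q.2 z)),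
    integral_conj, Complex.mul_conj]
  have : ∫ z, FF lam h q.1 q.2 z ∂(nu.prod nu) = EE lam h q.1 q.2 * EE lam h q.1 q.2 := by
    unfold FF EE
    exact integral_prod_mul (fun t => ph lam q.1 q.2 t * h t) (fun t => ph lam q.1 q.2 t * h t)
  rw [this, Complex.normSq_eq_norm_sq, norm_mul]
  push_cast; ring

lemma Phi_int (lam : ℝ) (h : ℝ → ℂ) (hm : Measurable h) (hi : Integrable h nu) :
    Integrable (fun r : (ℝ × ℝ) × ((ℝ × ℝ) × (ℝ × ℝ)) => Phi lam h r.1 r.2)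
      ((volume : Measure (ℝ × ℝ)).prod ((nu.prod nu).prod (nu.prod nu))) := by
  have hg : Integrable (fun x : ℝ => Real.exp (-x ^ 2)) := by
    simpa using integrable_exp_neg_mul_sq (b := 1) one_pos
  have h1 : Integrable (fun q : ℝ × ℝ => Real.exp (-q.1 ^ 2) * Real.exp (-q.2 ^ 2)) :=
    hg.mul_prod hg
  have h2 : Integrable (fun z : ℝ × ℝ => h z.1 * h z.2) (nu.prod nu) := hi.mul_prod hi
  have h3 := h1.ofReal (𝕜 := ℂ) |>.mul_prod (h2.mul_prod h2)
  refine h3.mono ?_ ?_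
  · have hF : Measurable (fun r : (ℝ × ℝ) × (ℝ × ℝ) => FF lam h r.1.1 r.1.2 r.2) := by
      unfold FF ph
      fun_prop
    have hF1 := hF.comp (f := fun r : (ℝ × ℝ) × ((ℝ × ℝ) × (ℝ × ℝ)) => (r.1, r.2.1)) (by fun_prop)
    have hF2 := hF.comp (f := fun r : (ℝ × ℝ) × ((ℝ × ℝ) × (ℝ × ℝ)) => (r.1, r.2.2)) (by fun_prop)
    have hF3 := (Complex.continuous_conj.measurable).comp hF2
    have hE : Measurable (fun r : (ℝ × ℝ) × ((ℝ × ℝ) × (ℝ × ℝ)) =>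
      ((Real.exp (-r.1.1 ^ 2) * Real.exp (-r.1.2 ^ 2) : ℝ) : ℂ)) := by fun_prop
    exact (hE.mul (hF1.mul hF3)).aestronglyMeasurable
  · refine Filter.Eventually.of_forall fun r => le_of_eq ?_
    simp only [Phi, FF, norm_mul, ph_norm, RCLike.norm_conj, one_mul, Complex.norm_real]
    simp
    left
    simp only [← Complex.ofReal_pow, ← Complex.ofReal_neg, Complex.norm_exp, Complex.ofReal_re]

lemma Phi_eq (lam : ℝ) (h : ℝ → ℂ) (q : ℝ × ℝ) (ω : (ℝ × ℝ) × (ℝ × ℝ)) :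
    Phi lam h q ω = ((h ω.1.1 * h ω.1.2) * conj (h ω.2.1 * h ω.2.2)) *
      (Complex.exp (-(1 - (lam * (ω.1.1 + ω.1.2 - ω.2.1 - ω.2.2) : ℝ) * Complex.I) * (q.1:ℂ) ^ 2) *
       (Complex.exp (Complex.I * (lam * (ω.1.1 ^ 2 + ω.1.2 ^ 2 - ω.2.1 ^ 2 - ω.2.2 ^ 2) : ℝ) * q.2) *
        Complex.exp (-1 * (q.2:ℂ) ^ 2))) := by
  unfold Phi FF ph
  simp only [map_mul, ← Complex.exp_conj, Complex.conj_ofReal, Complex.conj_I, Complex.ofReal_mul, Complex.ofReal_exp]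
  have : ∀ a b c d e f A B C D : ℂ, (a * b) * (c * A * (d * B) * (e * C * (f * D))) =
    (A * B * (C * D)) * (a * b * c * d * e * f) := by intros; ring
  rw [this]
  congr 1
  simp only [← Complex.exp_add]
  congr 1
  push_cast
  ring

lemma Phi_inner (lam : ℝ) (hl : 0 < lam) (h : ℝ → ℂ) (ω : (ℝ × ℝ) × (ℝ × ℝ)) :
    ‖∫ q : ℝ × ℝ, Phi lam h q ω‖ₑ ≤
      ENNReal.ofReal ((Real.pi / lam) ^ ((1:ℝ)/2)) * ENNReal.ofReal (Real.pi ^ ((1:ℝ)/2)) *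
      (((‖h ω.1.1‖ₑ * ‖h ω.1.2‖ₑ) * (‖h ω.2.1‖ₑ * ‖h ω.2.2‖ₑ)) * ker lam ω.1 ω.2) := by
  simp only [Phi_eq]
  rw [integral_const_mul, Measure.volume_eq_prod, integral_prod_mul
    (fun x : ℝ => Complex.exp (-(1 - (lam * (ω.1.1 + ω.1.2 - ω.2.1 - ω.2.2) : ℝ) * Complex.I) * (x:ℂ) ^ 2))
    (fun y : ℝ => Complex.exp (Complex.I * (lam * (ω.1.1 ^ 2 + ω.1.2 ^ 2 - ω.2.1 ^ 2 - ω.2.2 ^ 2) : ℝ) * y) *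
        Complex.exp (-1 * (y:ℂ) ^ 2))]
  rw [enorm_mul, enorm_mul (∫ x : ℝ, _), K2_bound]
  refine (mul_le_mul_right (mul_le_mul_left (K1_bound lam _ hl) _) _).trans (le_of_eq ?_)
  have : ∀ z : ℂ, ‖conj z‖ₑ = ‖z‖ₑ := fun z => by
    rw [← ofReal_norm, ← ofReal_norm, RCLike.norm_conj]
  rw [enorm_mul, this, enorm_mul, enorm_mul]
  unfold ker
  ring

noncomputable def cE : ℝ≥0∞ := ENNReal.ofReal (Real.exp 2) * (ENNReal.ofReal Real.pi * (4 * cA * cM))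

lemma core (lam : ℝ) (hl : 0 < lam) (h : ℝ → ℂ) (hm : Measurable h) (hi : Integrable h nu) :
    ∫⁻ q : ℝ × ℝ in Icc (-1:ℝ) 1 ×ˢ Icc (-1:ℝ) 1, ‖EE lam h q.1 q.2‖ₑ ^ 4 ≤
      cE * ENNReal.ofReal (lam ^ (-(3:ℝ)/2)) * ∫⁻ t, ‖h t‖ₑ ^ 4 ∂nu := by
  have hPi := Phi_int lam h hm hi
  set g : ℝ × ℝ → ℝ := fun q => Real.exp (-q.1 ^ 2) * Real.exp (-q.2 ^ 2) * ‖EE lam h q.1 q.2‖ ^ 4 with hg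
  have hg0 : ∀ q, 0 ≤ g q := fun q => by positivity
  have hgC : Integrable (fun q => ((g q : ℝ) : ℂ)) := by
    simp only [hg, EE_four]
    exact hPi.integral_prod_left
  have hgR : Integrable g := by simpa using hgC.re
  have s1 : ∫⁻ q : ℝ × ℝ in Icc (-1:ℝ) 1 ×ˢ Icc (-1:ℝ) 1, ‖EE lam h q.1 q.2‖ₑ ^ 4 ≤
      ENNReal.ofReal (Real.exp 2) * ∫⁻ q, ENNReal.ofReal (g q) := by
    rw [← lintegral_const_mul' _ _ (by simp)]
    refine (setLIntegral_mono' (measurableSet_Icc.prod measurableSet_Icc) ?_).trans (setLIntegral_le_lintegral _ _)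
    rintro ⟨x, y⟩ ⟨⟨hx1, hx2⟩, hy1, hy2⟩
    simp only at hx1 hx2 hy1 hy2 ⊢
    rw [← ofReal_norm, ← ENNReal.ofReal_pow (norm_nonneg _), ← ENNReal.ofReal_mul (by positivity)]
    apply ENNReal.ofReal_le_ofReal
    simp only [hg]
    rw [← mul_assoc, ← Real.exp_add, ← Real.exp_add]
    apply le_mul_of_one_le_left (by positivity)
    apply Real.one_le_exp
    nlinarith
  have s2 : ∫⁻ q, ENNReal.ofReal (g q) = ‖∫ ω, ∫ q, Phi lam h q ω ∂volume ∂((nu.prod nu).prod (nu.prod nu))‖ₑ := by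
    rw [← ofReal_integral_eq_lintegral_ofReal hgR (Filter.Eventually.of_forall hg0)]
    rw [← integral_integral_swap hPi]
    simp only [← EE_four]
    have : ∫ q, ((g q : ℝ) : ℂ) = ((∫ q, g q : ℝ) : ℂ) := integral_ofReal
    change _ = ‖∫ q, ((g q : ℝ) : ℂ)‖ₑ
    rw [this, ← ofReal_norm, Complex.norm_real, Real.norm_of_nonneg (integral_nonneg hg0)]
  have hn : Measurable (fun t => ‖h t‖ₑ) := hm.enorm
  have s3 := aux_quad lam hl _ hn
  have s4 : ∫⁻ q, ENNReal.ofReal (g q) ≤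
      ENNReal.ofReal ((Real.pi / lam) ^ ((1:ℝ)/2)) * ENNReal.ofReal (Real.pi ^ ((1:ℝ)/2)) *
      (2 * ((2 * cA * ∫⁻ t, ‖h t‖ₑ ^ 4 ∂nu) * (cM * ENNReal.ofReal lam⁻¹))) := by
    rw [s2]
    refine (enorm_integral_le_lintegral_enorm _).trans ?_
    refine (lintegral_mono fun ω => Phi_inner lam hl h ω).trans ?_
    rw [lintegral_const_mul' _ _ (by finiteness)]
    gcongr
  refine s1.trans ((mul_le_mul_right s4 _).trans (le_of_eq ?_))
  have e : ENNReal.ofReal ((Real.pi / lam) ^ ((1:ℝ)/2)) * ENNReal.ofReal (Real.pi ^ ((1:ℝ)/2)) * ENNReal.ofReal lam⁻¹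
      = ENNReal.ofReal Real.pi * ENNReal.ofReal (lam ^ (-(3:ℝ)/2)) := by
    rw [← ENNReal.ofReal_mul (by positivity), ← ENNReal.ofReal_mul (by positivity), ← ENNReal.ofReal_mul (by positivity)]
    congr 1
    rw [Real.div_rpow (by positivity) hl.le, ← Real.rpow_neg_one, show (-(3:ℝ)/2) = -(1/2) + -1 by norm_num,
      Real.rpow_add hl, Real.rpow_neg hl.le (1/2)]
    have : Real.pi ^ ((1:ℝ)/2) * Real.pi ^ ((1:ℝ)/2) = Real.pi := by
      rw [← Real.rpow_add Real.pi_pos]; norm_num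
    calc _ = (Real.pi ^ ((1:ℝ)/2) * Real.pi ^ ((1:ℝ)/2)) * ((lam ^ ((1:ℝ)/2))⁻¹ * lam ^ (-1:ℝ)) := by
          rw [div_eq_mul_inv]; ring
      _ = _ := by rw [this]
  calc _ = ENNReal.ofReal (Real.exp 2) * ((ENNReal.ofReal ((Real.pi / lam) ^ ((1:ℝ)/2)) * ENNReal.ofReal (Real.pi ^ ((1:ℝ)/2)) * ENNReal.ofReal lam⁻¹) * (4 * cA * cM)) * ∫⁻ t, ‖h t‖ₑ ^ 4 ∂nu := by ring
    _ = _ := by rw [e]; unfold cE; ring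

lemma T_eq (lam : ℝ) (ψ : ℝ → ℝ → ℝ → ℂ) (hψ : inU ψ) (g : ℝ → ℂ) (x y : ℝ) :
    T lam ψ g x y = ∫ t, ph lam x y t * ψ x y t * g t ∂nu := by
  unfold T nu
  rw [setIntegral_eq_integral_of_forall_compl_eq_zero]
  · congr 1; ext t
    unfold ph
    congr 3
    push_cast; ring
  · intro t ht
    have : ψ x y t = 0 := by
      by_contra h
      exact ht (abs_le.1 (hψ.2.1 x y t h).2.2)
    simp [this]

lemma psi_smooth (ψ : ℝ → ℝ → ℝ → ℂ) (hψ : inU ψ) (x y : ℝ) : ContDiff ℝ (⊤ : ℕ∞) (ψ x y) := by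
  have : ContDiff ℝ (⊤ : ℕ∞) (fun t : ℝ => ((x, y, t) : ℝ × ℝ × ℝ)) := by fun_prop
  exact hψ.1.comp this

lemma psi_ftc (ψ : ℝ → ℝ → ℝ → ℂ) (hψ : inU ψ) (x y t : ℝ) (ht : |t| ≤ 1) :
    ψ x y t = ∫ τ in Ioc (-2:ℝ) 1, (Ioi τ).indicator (fun _ => deriv (ψ x y) τ) t := by
  have hs := psi_smooth ψ hψ x y
  rw [abs_le] at ht
  have hd : Continuous (deriv (ψ x y)) := hs.continuous_deriv (by simp)
  have h1 : ∫ τ in (-2:ℝ)..t, deriv (ψ x y) τ = ψ x y t - ψ x y (-2) :=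
    intervalIntegral.integral_deriv_eq_sub (fun z _ => (hs.differentiable (by simp)) z)
      (hd.intervalIntegrable _ _)
  have h2 : ψ x y (-2) = 0 := by
    by_contra h
    have := (hψ.2.1 x y _ h).2.2
    norm_num at this
  rw [h2, sub_zero, intervalIntegral.integral_of_le (by linarith)] at h1
  rw [← h1, integral_Ioc_eq_integral_Ioo, ← integral_indicator measurableSet_Ioo,
    ← integral_indicator measurableSet_Ioc]
  congr 1; ext τ
  simp only [indicator, mem_Ioo, mem_Ioc, mem_Ioi]
  by_cases h : -2 < τ ∧ τ < t
  · rw [if_pos h, if_pos ⟨h.1, by linarith [h.2]⟩, if_pos h.2]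
  · rw [if_neg h]
    split_ifs with h3 h4
    · exact absurd ⟨h3.1, h4⟩ h
    · rfl
    · rfl

lemma T_bound (lam : ℝ) (ψ : ℝ → ℝ → ℝ → ℂ) (hψ : inU ψ) (g : ℝ → ℂ) (hm : Measurable g)
    (hi : Integrable g nu) (x y : ℝ) :
    ‖T lam ψ g x y‖ₑ ≤ ∫⁻ τ in Ioc (-2:ℝ) 1, ‖EE lam ((Ioi τ).indicator g) x y‖ₑ := by
  have hs := psi_smooth ψ hψ x y
  have hd : Continuous (deriv (ψ x y)) := hs.continuous_deriv (by simp)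
  have hd1 : ∀ τ, ‖deriv (ψ x y) τ‖ ≤ 1 := fun τ => by
    have := hψ.2.2 1 le_rfl (by norm_num) x y τ
    rwa [iteratedDeriv_one] at this
  set Ψ : ℝ → ℝ → ℂ := fun t τ => {p : ℝ × ℝ | p.2 < p.1}.indicator
    (fun p => ph lam x y p.1 * g p.1 * deriv (ψ x y) p.2) (t, τ) with hΨ
  have hdm := hd.measurable
  have hΨi : Integrable (Function.uncurry Ψ) (nu.prod (volume.restrict (Ioc (-2:ℝ) 1))) := by
    have h3 := hi.mul_prod (integrable_const (μ := volume.restrict (Ioc (-2:ℝ) 1)) (1:ℂ))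
    refine h3.mono ?_ ?_
    · apply Measurable.aestronglyMeasurable
      have : Function.uncurry Ψ = {p : ℝ × ℝ | p.2 < p.1}.indicator
        (fun p => ph lam x y p.1 * g p.1 * deriv (ψ x y) p.2) := by ext p; rfl
      rw [this]
      refine Measurable.indicator ?_ (measurableSet_lt measurable_snd measurable_fst)
      unfold ph; fun_prop
    · refine Filter.Eventually.of_forall fun p => ?_
      refine (norm_indicator_le_norm_self (fun p : ℝ × ℝ => ph lam x y p.1 * g p.1 * deriv (ψ x y) p.2) p).trans ?_
      simp only [norm_mul, ph_norm, one_mul, mul_one]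
      exact mul_le_of_le_one_right (norm_nonneg _) (hd1 _)
  have h1 : T lam ψ g x y = ∫ t, (∫ τ in Ioc (-2:ℝ) 1, Ψ t τ) ∂nu := by
    rw [T_eq lam ψ hψ]
    apply integral_congr_ae
    filter_upwards [nu_ae] with t ht
    rw [psi_ftc ψ hψ x y t ht, mul_right_comm, ← integral_const_mul]
    congr 1; ext τ
    simp only [hΨ, indicator, mem_Ioi, mem_ofPred_eq]
    split_ifs <;> simp
  have h2 : ∀ τ, ∫ t, Ψ t τ ∂nu = deriv (ψ x y) τ * EE lam ((Ioi τ).indicator g) x y := by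
    intro τ
    unfold EE
    rw [← integral_const_mul]
    congr 1; ext t
    simp only [hΨ, indicator, mem_Ioi, mem_ofPred_eq]
    split_ifs
    · ring
    · simp
  rw [h1, integral_integral_swap hΨi]
  refine (enorm_integral_le_lintegral_enorm _).trans (lintegral_mono fun τ => ?_)
  simp only [h2]
  rw [enorm_mul]
  refine mul_le_of_le_one_left zero_le ?_
  rw [← ofReal_norm]
  exact ENNReal.ofReal_le_one.2 (hd1 τ)

lemma pow4_bound (a : ℝ → ℝ≥0∞) (ha : Measurable a) :
    (∫⁻ τ in Ioc (-2:ℝ) 1, a τ) ^ 4 ≤ 27 * ∫⁻ τ in Ioc (-2:ℝ) 1, a τ ^ 4 := by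
  have hc : (4:ℝ).HolderConjugate (4/3) := by
    rw [Real.holderConjugate_iff]; norm_num
  have h := ENNReal.lintegral_mul_le_Lp_mul_Lq (volume.restrict (Ioc (-2:ℝ) 1)) hc
    ha.aemeasurable (aemeasurable_const (b := (1:ℝ≥0∞)))
  simp only [Pi.mul_apply, mul_one, ENNReal.one_rpow, lintegral_one, Measure.restrict_apply_univ, Real.volume_Ioc] at h
  have h' := pow_le_pow_left' h 4
  refine h'.trans (le_of_eq ?_)
  rw [mul_pow, ← ENNReal.rpow_natCast, ← ENNReal.rpow_natCast, ← ENNReal.rpow_mul, ← ENNReal.rpow_mul]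
  have e1 : (1 / 4 * ((4:ℕ):ℝ)) = 1 := by norm_num
  have e2 : (1 / (4/3) * ((4:ℕ):ℝ)) = ((3:ℕ):ℝ) := by norm_num
  rw [e1, e2, ENNReal.rpow_one, ENNReal.rpow_natCast, mul_comm]
  have e3 : ENNReal.ofReal (1 - -2) = 3 := by norm_num
  rw [e3]
  congr 1
  · norm_num
  · congr 1; ext τ
    exact_mod_cast ENNReal.rpow_natCast (a τ) 4

lemma EE_meas (lam : ℝ) (g : ℝ → ℂ) (hm : Measurable g) :
    Measurable (fun p : (ℝ × ℝ) × ℝ => EE lam ((Ioi p.2).indicator g) p.1.1 p.1.2) := by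
  have h : StronglyMeasurable (fun r : ((ℝ × ℝ) × ℝ) × ℝ =>
      {r : ((ℝ × ℝ) × ℝ) × ℝ | r.1.2 < r.2}.indicator (fun r => ph lam r.1.1.1 r.1.1.2 r.2 * g r.2) r) := by
    apply Measurable.stronglyMeasurable
    refine Measurable.indicator ?_ (measurableSet_lt (by fun_prop) (by fun_prop))
    unfold ph; fun_prop
  have h2 := (h.integral_prod_right' (ν := nu)).measurable
  convert h2 using 2 with p
  unfold EE
  congr 1; ext t
  simp only [indicator, mem_Ioi, mem_ofPred_eq]
  split_ifs <;> simp

lemma main_meas (lam : ℝ) (hl : 0 < lam) (ψ : ℝ → ℝ → ℝ → ℂ) (hψ : inU ψ) (g : ℝ → ℂ) (hm : Measurable g)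
    (hi : Integrable g nu) (h4 : ∫⁻ t, ‖g t‖ₑ ^ 4 ∂nu ≤ 1) :
    ∫⁻ q : ℝ × ℝ, ‖T lam ψ g q.1 q.2‖ₑ ^ 4 ≤ 81 * cE * ENNReal.ofReal (lam ^ (-(3:ℝ)/2)) := by
  have hE := EE_meas lam g hm
  set S : Set (ℝ × ℝ) := Icc (-1:ℝ) 1 ×ˢ Icc (-1:ℝ) 1 with hS
  have hSm : MeasurableSet S := measurableSet_Icc.prod measurableSet_Icc
  have h1 : ∫⁻ q : ℝ × ℝ, ‖T lam ψ g q.1 q.2‖ₑ ^ 4 = ∫⁻ q : ℝ × ℝ in S, ‖T lam ψ g q.1 q.2‖ₑ ^ 4 := by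
    rw [← lintegral_indicator hSm]
    congr 1; ext q
    by_cases hq : q ∈ S
    · rw [indicator_of_mem hq]
    · rw [indicator_of_notMem hq]
      have : ∀ t, ψ q.1 q.2 t = 0 := by
        intro t
        by_contra h
        have := hψ.2.1 _ _ _ h
        exact hq ⟨abs_le.1 this.1, abs_le.1 this.2.1⟩
      simp [T, this]
  rw [h1]
  calc _ ≤ ∫⁻ q : ℝ × ℝ in S, 27 * ∫⁻ τ in Ioc (-2:ℝ) 1, ‖EE lam ((Ioi τ).indicator g) q.1 q.2‖ₑ ^ 4 := by
        apply lintegral_mono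
        intro q
        refine (pow_le_pow_left' (T_bound lam ψ hψ g hm hi q.1 q.2) 4).trans (pow4_bound _ ?_)
        exact (hE.comp (measurable_const.prodMk measurable_id)).enorm
    _ = 27 * ∫⁻ q : ℝ × ℝ in S, ∫⁻ τ in Ioc (-2:ℝ) 1, ‖EE lam ((Ioi τ).indicator g) q.1 q.2‖ₑ ^ 4 :=
        lintegral_const_mul' _ _ (by simp)
    _ = 27 * ∫⁻ τ in Ioc (-2:ℝ) 1, ∫⁻ q : ℝ × ℝ in S, ‖EE lam ((Ioi τ).indicator g) q.1 q.2‖ₑ ^ 4 := by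
        rw [lintegral_lintegral_swap]
        exact (hE.enorm.pow_const 4).aemeasurable
    _ ≤ 27 * ∫⁻ τ in Ioc (-2:ℝ) 1, cE * ENNReal.ofReal (lam ^ (-(3:ℝ)/2)) := by
        gcongr with τ
        refine (core lam hl _ (hm.indicator measurableSet_Ioi) (hi.indicator measurableSet_Ioi)).trans ?_
        refine mul_le_of_le_one_right zero_le (le_trans ?_ h4)
        apply lintegral_mono
        intro t
        simp only
        gcongr
        exact enorm_indicator_le_enorm_self _ _
    _ = _ := by
        rw [lintegral_const, Measure.restrict_apply_univ, Real.volume_Ioc]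
        have e3 : ENNReal.ofReal (1 - -2) = 3 := by norm_num
        rw [e3]; ring

lemma reduce (lam : ℝ) (ψ : ℝ → ℝ → ℝ → ℂ) (hψ : inU ψ) (f : ℝ → ℂ) (hf : ∫⁻ t, ‖f t‖ₑ ^ 4 ≤ 1) :
    ∃ g : ℝ → ℂ, Measurable g ∧ Integrable g nu ∧ ∫⁻ t, ‖g t‖ₑ ^ 4 ∂nu ≤ 1 ∧
      ∀ x y, ‖T lam ψ f x y‖ₑ ≤ ‖T lam ψ g x y‖ₑ := by
  let ig : ℝ × ℝ → ℝ → ℂ := fun q t =>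
    Complex.exp (Complex.I * lam * (q.1 ^ 2 * t + q.2 * t ^ 2)) * ψ q.1 q.2 t
  have hig : ∀ q, Continuous (ig q) := by
    intro q
    have := (psi_smooth ψ hψ q.1 q.2).continuous
    fun_prop
  let ι := {q : ℝ × ℝ // Integrable (fun t => ig q t * f t)}
  let S : ι → Set ℝ := fun q => {t | ig q.1 t ≠ 0}
  have hSo : ∀ q, IsOpen (S q) := fun q => isOpen_ne_fun (hig q.1) continuous_const
  obtain ⟨A, hAc, hA⟩ := TopologicalSpace.isOpen_iUnion_countable S hSo
  set W : Set ℝ := ⋃ q, S q with hW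
  have hWo : IsOpen W := isOpen_iUnion hSo
  have hfS : ∀ q, AEStronglyMeasurable f (volume.restrict (S q)) := by
    intro q
    have h1 : AEStronglyMeasurable (fun t => (ig q.1 t)⁻¹ * (ig q.1 t * f t)) (volume.restrict (S q)) :=
      ((hig q.1).measurable.inv.aestronglyMeasurable).mul q.2.1.restrict
    refine h1.congr (ae_restrict_of_forall_mem (hSo q).measurableSet fun t ht => ?_)
    exact inv_mul_cancel_left₀ ht _
  have hfW : AEStronglyMeasurable f (volume.restrict W) := by
    rw [← hA]
    have := hAc.to_subtype
    rw [biUnion_eq_iUnion]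
    exact AEStronglyMeasurable.iUnion fun q => hfS q.1
  set g : ℝ → ℂ := W.indicator (hfW.mk f) with hg
  have hgm : Measurable g := hfW.stronglyMeasurable_mk.measurable.indicator hWo.measurableSet
  have hgf : g =ᵐ[volume] W.indicator f := by
    have := (ae_restrict_iff' hWo.measurableSet).1 hfW.ae_eq_mk
    filter_upwards [this] with t ht
    by_cases h : t ∈ W
    · rw [hg, indicator_of_mem h, indicator_of_mem h, ht h]
    · rw [hg, indicator_of_notMem h, indicator_of_notMem h]
  have hg4 : ∫⁻ t, ‖g t‖ₑ ^ 4 ∂nu ≤ 1 := by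
    calc _ ≤ ∫⁻ t, ‖g t‖ₑ ^ 4 := setLIntegral_le_lintegral _ _
      _ ≤ ∫⁻ t, ‖f t‖ₑ ^ 4 := by
        apply lintegral_mono_ae
        filter_upwards [hgf] with t ht
        rw [ht]
        gcongr
        exact enorm_indicator_le_enorm_self _ _
      _ ≤ 1 := hf
  have hgi : Integrable g nu := by
    have : MemLp g 4 nu := by
      refine ⟨hgm.aestronglyMeasurable, ?_⟩
      rw [eLpNorm_lt_top_iff_lintegral_rpow_enorm_lt_top (by norm_num) (by norm_num)]
      refine lt_of_le_of_lt (le_trans (le_of_eq ?_) hg4) ENNReal.one_lt_top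
      congr 1; ext t
      simp only [ENNReal.toReal_ofNat]
      exact_mod_cast ENNReal.rpow_natCast _ 4
    exact memLp_one_iff_integrable.1 (this.mono_exponent (by norm_num))
  refine ⟨g, hgm, hgi, hg4, fun x y => ?_⟩
  by_cases hq : Integrable (fun t => ig (x, y) t * f t)
  · have : T lam ψ f x y = T lam ψ g x y := by
      unfold T
      apply integral_congr_ae
      filter_upwards [hgf] with t ht
      rw [ht]
      by_cases h : t ∈ W
      · rw [indicator_of_mem h]
      · have : ig (x, y) t = 0 := by
          by_contra h'
          exact h (mem_iUnion.2 ⟨⟨(x, y), hq⟩, h'⟩)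
        simp only [ig] at this
        rw [this]; simp
    rw [this]
  · have : T lam ψ f x y = 0 := integral_undef hq
    rw [this]; simp

lemma cE_fin : cE ≠ ⊤ := by
  have h1 := aux_sing_fin
  have h2 := cB_fin
  have h1' : cA ≠ ⊤ := h1
  unfold cE cM
  finiteness

lemma eLp4 {α : Type*} [MeasurableSpace α] (μ : Measure α) (F : α → ℂ) :
    eLpNorm F 4 μ = (∫⁻ a, ‖F a‖ₑ ^ 4 ∂μ) ^ ((1:ℝ)/4) := by
  rw [eLpNorm_eq_lintegral_rpow_enorm_toReal (by norm_num) (by norm_num)]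
  simp only [ENNReal.toReal_ofNat]
  congr 2; ext t
  exact_mod_cast ENNReal.rpow_natCast _ 4

theorem Q4_decay :
    ∃ C : ℝ, 0 < C ∧ ∀ lam : ℝ, 1 ≤ lam →
      Q4 lam ≤ ENNReal.ofReal (C * lam ^ (-(3 : ℝ) / 8)) := by
  have hfin : (81 * cE) ≠ ⊤ := by
    have := cE_fin
    finiteness
  refine ⟨(81 * cE).toReal ^ ((1:ℝ)/4) + 1, by positivity, fun lam hlam => ?_⟩
  have hl : 0 < lam := by linarith
  unfold Q4
  refine iSup_le fun ψ => iSup_le fun hψ => iSup_le fun f => iSup_le fun hf => ?_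
  have hf4 : ∫⁻ t, ‖f t‖ₑ ^ 4 ≤ 1 := by
    rw [eLp4] at hf
    by_contra h
    push Not at h
    have := ENNReal.one_lt_rpow h (show (0:ℝ) < 1/4 by norm_num)
    exact absurd hf (not_le.2 this)
  obtain ⟨g, hgm, hgi, hg4, hle⟩ := reduce lam ψ hψ f hf4
  have h1 := main_meas lam hl ψ hψ g hgm hgi hg4
  rw [eLp4]
  have h2 : ∫⁻ q : ℝ × ℝ, ‖T lam ψ f q.1 q.2‖ₑ ^ 4 ≤ 81 * cE * ENNReal.ofReal (lam ^ (-(3:ℝ)/2)) := by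
    refine le_trans (lintegral_mono fun q => ?_) h1
    exact pow_le_pow_left' (hle q.1 q.2) 4
  calc _ ≤ (81 * cE * ENNReal.ofReal (lam ^ (-(3:ℝ)/2))) ^ ((1:ℝ)/4) := by gcongr
    _ = ENNReal.ofReal ((81 * cE).toReal ^ ((1:ℝ)/4) * lam ^ (-(3:ℝ)/8)) := by
        rw [← ENNReal.ofReal_toReal hfin, ← ENNReal.ofReal_mul (by positivity),
          ENNReal.ofReal_rpow_of_nonneg (by positivity) (by norm_num),
          Real.mul_rpow (by positivity) (by positivity), ← Real.rpow_mul hl.le,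
          ENNReal.toReal_ofReal (by positivity)]
        norm_num
    _ ≤ _ := by
        apply ENNReal.ofReal_le_ofReal
        gcongr
        linarith
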